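/- Let A : ℕ → ℤ and let j : ℕ. For every i ≤ j, the value RMQ A i j is an element of the stack List.foldl step [] ((List.range (j+1)).map A). -/

import Mathlib

/-- Range minimum query: the minimum of `A k` over `k ∈ Finset.Icc i j`. -/
def RMQ (A : ℕ → ℤ) (i j : ℕ) : ℤ :=
  if h : i ≤ j then (Finset.Icc i j).inf' (by simpa using h) A else A i

/-- Stack step: pop every element ≥ v from the top, then push v (head = top). -/
def step (S : List ℤ) (v : ℤ) : List ℤ := v :: S.dropWhile (fun x => v ≤ x)

theorem List.mem_dropWhile_of_mem_of_not {α : Type*} {p : α → Bool} {l : List α} {x : α}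
    (hx : x ∈ l) (hp : ¬ p x) : x ∈ l.dropWhile p := by
  induction l with
  | nil => simp at hx
  | cons a l ih =>
    rw [List.dropWhile_cons]
    split_ifs with ha
    · rcases List.mem_cons.1 hx with rfl | h
      · exact absurd ha hp
      · exact ih h
    · exact hx

theorem min_mem_step {S : List ℤ} {x : ℤ} (v : ℤ) (hx : x ∈ S) : min x v ∈ step S v := by
  rcases le_or_gt v x with h | h
  · simp [step, min_eq_right h]
  · rw [min_eq_left h.le]
    exact List.mem_cons_of_mem _ (List.mem_dropWhile_of_mem_of_not hx (by simpa using h))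

theorem RMQ_self (A : ℕ → ℤ) (i : ℕ) : RMQ A i i = A i := by
  simp [RMQ]

theorem RMQ_succ_right (A : ℕ → ℤ) {i j : ℕ} (hij : i ≤ j) :
    RMQ A i (j + 1) = min (RMQ A i j) (A (j + 1)) := by
  refine eq_of_forall_le_iff fun c => ?_
  simp only [RMQ, dif_pos hij, dif_pos (hij.trans j.le_succ), Finset.le_inf'_iff, le_min_iff,
    Finset.mem_Icc]
  grind

theorem RMQ_mem_stack (A : ℕ → ℤ) (j : ℕ) (i : ℕ) (hij : i ≤ j) :
    RMQ A i j ∈ List.foldl step [] ((List.range (j + 1)).map A) := by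
  induction j with
  | zero =>
    obtain rfl := Nat.le_zero.1 hij
    simp [RMQ_self, step]
  | succ j ih =>
    rw [List.range_succ, List.map_append, List.foldl_append]
    rcases Nat.le_succ_iff.1 hij with h | rfl
    · rw [RMQ_succ_right A h]
      exact min_mem_step _ (ih h)
    · simp [RMQ_self, step]
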